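/- The flatness of Riemann's non-differentiable function in the sense of high-pass filtering tends to infinity: lim_{N→∞} F_R(N) = +∞, where F_R(N) = ‖R_{≥N}‖_{L⁴(𝕋)}⁴ / ‖R_{≥N}‖_{L²(𝕋)}⁴. In other words, Riemann's non-differentiable function is intermittent in the sense of high-pass filtering. -/

import Mathlib

open Real MeasureTheory

/-- `σ k = 1` if `k` is a perfect square, `0` otherwise. -/
noncomputable def sqIndicator (k : ℕ) : ℝ := if IsSquare k then 1 else 0

/-- The character `e_k(x) = e^{2πikx}`. -/
noncomputable def eChar (k : ℕ) (x : ℝ) : ℂ :=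
  Complex.exp (2 * Real.pi * Complex.I * (k : ℂ) * (x : ℂ))

/-- Riemann's non-differentiable function `R(x) = ∑_{k≥1} (σ_k/k) e^{2πikx}
    = ∑_{n≥1} e^{2πin²x}/n²`. -/
noncomputable def RiemannF (x : ℝ) : ℂ :=
  ∑' k : ℕ, ((sqIndicator k / k : ℝ) : ℂ) * eChar k x

/-- High-pass filter `R_{≥N}(x) = ∑_{k ≥ N} (σ_k/k) e^{2πikx}`. -/
noncomputable def RiemannHigh (N : ℕ) (x : ℝ) : ℂ :=
  ∑' k : ℕ, if N ≤ k then ((sqIndicator k / k : ℝ) : ℂ) * eChar k x else 0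

/-- The flatness in the sense of high-pass filtering,
`F_R(N) = ‖R_{≥N}‖_{L⁴}⁴ / ‖R_{≥N}‖_{L²}⁴`. -/
noncomputable def flatnessHP (N : ℕ) : ℝ :=
  (∫ x in (0:ℝ)..1, ‖RiemannHigh N x‖ ^ 4) /
    (∫ x in (0:ℝ)..1, ‖RiemannHigh N x‖ ^ 2) ^ 2

theorem integral_eChar_mul_conj (k l : ℕ) :
    ∫ x in (0:ℝ)..1, eChar k x * (starRingEnd ℂ) (eChar l x) = if k = l then 1 else 0 := by
  have h : ∀ x : ℝ, eChar k x * (starRingEnd ℂ) (eChar l x) =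
      Complex.exp ((2 * π * Complex.I * ((k : ℂ) - l)) * x) := by
    intro x
    rw [eChar, eChar, ← Complex.exp_conj, ← Complex.exp_add]
    congr 1
    simp only [map_mul, Complex.conj_ofReal, Complex.conj_I, map_natCast, map_ofNat]
    ring
  simp_rw [h]
  split_ifs with hkl
  · simp [hkl]
  · have hne : (2 * π * Complex.I * ((k : ℂ) - l)) ≠ 0 :=
      mul_ne_zero Complex.two_pi_I_ne_zero (sub_ne_zero.2 (by exact_mod_cast hkl))
    rw [integral_exp_mul_complex hne]
    have h1 : Complex.exp (2 * π * Complex.I * ((k : ℂ) - l)) = 1 :=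
      Complex.exp_eq_one_iff.2 ⟨(k : ℤ) - l, by push_cast; ring⟩
    simp [h1]

theorem continuous_eChar (k : ℕ) : Continuous (eChar k) := by
  unfold eChar
  fun_prop

theorem norm_eChar (k : ℕ) (x : ℝ) : ‖eChar k x‖ = 1 := by
  have : eChar k x = Complex.exp ((2 * π * k * x : ℝ) * Complex.I) := by
    rw [eChar]
    congr 1
    push_cast
    ring
  rw [this, Complex.norm_exp_ofReal_mul_I]

theorem eChar_mul (k l : ℕ) (x : ℝ) : eChar k x * eChar l x = eChar (k + l) x := by
  simp only [eChar, ← Complex.exp_add]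
  congr 1
  push_cast
  ring

/-- Parseval's identity for a trigonometric polynomial with possibly repeated frequencies. -/
theorem integral_norm_sq_sum_eChar {ι : Type*} (s : Finset ι) (c : ι → ℝ) (ψ : ι → ℕ) :
    ∫ x in (0:ℝ)..1, ‖∑ i ∈ s, (c i : ℂ) * eChar (ψ i) x‖ ^ 2 =
      ∑ i ∈ s, ∑ j ∈ s, if ψ i = ψ j then c i * c j else 0 := by
  have h : ∀ x : ℝ, ((‖∑ i ∈ s, (c i : ℂ) * eChar (ψ i) x‖ ^ 2 : ℝ) : ℂ) =
      ∑ i ∈ s, ∑ j ∈ s,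
        ((c i * c j : ℝ) : ℂ) * (eChar (ψ i) x * (starRingEnd ℂ) (eChar (ψ j) x)) := by
    intro x
    rw [Complex.ofReal_pow, ← Complex.mul_conj', map_sum, Finset.sum_mul_sum]
    refine Finset.sum_congr rfl fun i _ => Finset.sum_congr rfl fun j _ => ?_
    simp only [map_mul, Complex.conj_ofReal]
    push_cast
    ring
  have hc : ∀ i j, Continuous fun x : ℝ =>
      ((c i * c j : ℝ) : ℂ) * (eChar (ψ i) x * (starRingEnd ℂ) (eChar (ψ j) x)) := fun i j =>
    continuous_const.mul ((continuous_eChar _).mul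
      (Complex.continuous_conj.comp (continuous_eChar _)))
  apply Complex.ofReal_injective
  rw [← intervalIntegral.integral_ofReal]
  simp_rw [h]
  rw [intervalIntegral.integral_finsetSum fun i _ =>
    (continuous_finsetSum s fun j _ => hc i j).intervalIntegrable _ _]
  rw [Complex.ofReal_sum]
  refine Finset.sum_congr rfl fun i _ => ?_
  rw [intervalIntegral.integral_finsetSum fun j _ => (hc i j).intervalIntegrable _ _,
    Complex.ofReal_sum]
  refine Finset.sum_congr rfl fun j _ => ?_
  rw [intervalIntegral.integral_const_mul, integral_eChar_mul_conj]
  split_ifs <;> simp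

theorem norm_coeff_mul_eChar {w : ℕ → ℝ} (hw : ∀ n, 0 ≤ w n) (φ : ℕ → ℕ)
    (n : ℕ) (x : ℝ) : ‖(w n : ℂ) * eChar (φ n) x‖ = w n := by
  rw [norm_mul, norm_eChar, mul_one, Complex.norm_real, Real.norm_of_nonneg (hw n)]

theorem tendsto_integral_norm_pow_partial_sum {w : ℕ → ℝ} (hw : ∀ n, 0 ≤ w n)
    (hs : Summable w) (φ : ℕ → ℕ) (m : ℕ) :
    Filter.Tendsto
      (fun L => ∫ x in (0:ℝ)..1, ‖∑ n ∈ Finset.range L, (w n : ℂ) * eChar (φ n) x‖ ^ m)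
      Filter.atTop
      (nhds (∫ x in (0:ℝ)..1, ‖∑' n, (w n : ℂ) * eChar (φ n) x‖ ^ m)) := by
  refine intervalIntegral.tendsto_integral_filter_of_dominated_convergence
    (fun _ => (∑' n, w n) ^ m) ?_ ?_ (by simp) ?_
  · refine Filter.Eventually.of_forall fun L => Continuous.aestronglyMeasurable ?_
    exact (continuous_finsetSum _ fun n _ =>
      continuous_const.mul (continuous_eChar _)).norm.pow m
  · refine Filter.Eventually.of_forall fun L => Filter.Eventually.of_forall fun x _ => ?_
    rw [norm_pow, norm_norm]
    gcongr
    calc ‖∑ n ∈ Finset.range L, (w n : ℂ) * eChar (φ n) x‖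
        ≤ ∑ n ∈ Finset.range L, ‖(w n : ℂ) * eChar (φ n) x‖ := norm_sum_le _ _
      _ = ∑ n ∈ Finset.range L, w n :=
        Finset.sum_congr rfl fun n _ => norm_coeff_mul_eChar hw φ n x
      _ ≤ ∑' n, w n := hs.sum_le_tsum _ fun n _ => hw n
  · refine Filter.Eventually.of_forall fun x _ => ?_
    have : Summable fun n => (w n : ℂ) * eChar (φ n) x :=
      Summable.of_norm (by simpa only [norm_coeff_mul_eChar hw φ] using hs)
    exact this.hasSum.tendsto_sum_nat.norm.pow m

theorem tendsto_sum_sq_integral_norm_sq {w : ℕ → ℝ} (hw : ∀ n, 0 ≤ w n)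
    (hs : Summable w) (φ : ℕ → ℕ) (hφ : Function.Injective φ) :
    Filter.Tendsto (fun L => ∑ n ∈ Finset.range L, w n ^ 2) Filter.atTop
      (nhds (∫ x in (0:ℝ)..1, ‖∑' n, (w n : ℂ) * eChar (φ n) x‖ ^ 2)) := by
  refine (tendsto_integral_norm_pow_partial_sum hw hs φ 2).congr fun L => ?_
  rw [integral_norm_sq_sum_eChar]
  refine Finset.sum_congr rfl fun n hn => ?_
  simp_rw [hφ.eq_iff]
  rw [Finset.sum_ite_eq, if_pos hn, sq]

/-- The fourth moment dominates the contribution of any finite set of additive quadruples. -/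
theorem sum_quadruples_le_integral_norm_pow_four {w : ℕ → ℝ} (hw : ∀ n, 0 ≤ w n)
    (hs : Summable w) (φ : ℕ → ℕ) (Q : Finset ((ℕ × ℕ) × (ℕ × ℕ)))
    (hQ : ∀ q ∈ Q, φ q.1.1 + φ q.1.2 = φ q.2.1 + φ q.2.2) :
    ∑ q ∈ Q, (w q.1.1 * w q.1.2) * (w q.2.1 * w q.2.2) ≤
      ∫ x in (0:ℝ)..1, ‖∑' n, (w n : ℂ) * eChar (φ n) x‖ ^ 4 := by
  obtain ⟨B, hB⟩ : ∃ B : ℕ, ∀ q ∈ Q, q.1.1 < B ∧ q.1.2 < B ∧ q.2.1 < B ∧ q.2.2 < B := by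
    refine ⟨Q.sup (fun q => q.1.1 + q.1.2 + q.2.1 + q.2.2) + 1, fun q hq => ?_⟩
    have := Finset.le_sup (f := fun q : (ℕ × ℕ) × (ℕ × ℕ) => q.1.1 + q.1.2 + q.2.1 + q.2.2) hq
    omega
  refine ge_of_tendsto (tendsto_integral_norm_pow_partial_sum hw hs φ 4) ?_
  filter_upwards [Filter.eventually_ge_atTop B] with L hL
  set s := Finset.range L ×ˢ Finset.range L with hs_def
  have h : ∀ x : ℝ, ‖∑ n ∈ Finset.range L, (w n : ℂ) * eChar (φ n) x‖ ^ 4 =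
      ‖∑ i ∈ s, ((w i.1 * w i.2 : ℝ) : ℂ) * eChar (φ i.1 + φ i.2) x‖ ^ 2 := by
    intro x
    rw [show 4 = 2 * 2 by norm_num, pow_mul, ← norm_pow, sq (∑ n ∈ _, _), Finset.sum_mul_sum,
      ← Finset.sum_product']
    congr 2
    refine Finset.sum_congr rfl fun i _ => ?_
    rw [← eChar_mul]
    push_cast
    ring
  simp_rw [h]
  rw [integral_norm_sq_sum_eChar s (fun i => w i.1 * w i.2) (fun i => φ i.1 + φ i.2),
    ← Finset.sum_product']
  have hsub : Q ⊆ s ×ˢ s := by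
    intro q hq
    have := hB q hq
    simp only [hs_def, Finset.mem_product, Finset.mem_range]
    omega
  have hnn : ∀ q : (ℕ × ℕ) × (ℕ × ℕ), 0 ≤ (w q.1.1 * w q.1.2) * (w q.2.1 * w q.2.2) := fun q =>
    mul_nonneg (mul_nonneg (hw _) (hw _)) (mul_nonneg (hw _) (hw _))
  calc ∑ q ∈ Q, (w q.1.1 * w q.1.2) * (w q.2.1 * w q.2.2)
      = ∑ q ∈ Q, if φ q.1.1 + φ q.1.2 = φ q.2.1 + φ q.2.2 then
          (w q.1.1 * w q.1.2) * (w q.2.1 * w q.2.2) else 0 :=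
        Finset.sum_congr rfl fun q hq => (if_pos (hQ q hq)).symm
    _ ≤ _ := Finset.sum_le_sum_of_subset_of_nonneg hsub fun q _ _ => by
        split_ifs
        · exact hnn q
        · exact le_rfl

/-- The quadruple `(p y + u x, p x - u y, p x + u y, p y - u x)`, whose first two and last two
entries have the same sum of squares. -/
def squareQuadruple (i : (_ : ℕ) × (ℕ × (ℕ × ℕ))) : (ℕ × ℕ) × (ℕ × ℕ) :=
  ((i.1 * i.2.2.2 + i.2.1 * i.2.2.1, i.1 * i.2.2.1 - i.2.1 * i.2.2.2),
    (i.1 * i.2.2.1 + i.2.1 * i.2.2.2, i.1 * i.2.2.2 - i.2.1 * i.2.2.1))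

/-- Parameters `(p, u, x, y)` for which `squareQuadruple` has all its entries comparable to `M`. -/
def quadrupleParams (P : Finset ℕ) (M : ℕ) : Finset ((_ : ℕ) × (ℕ × (ℕ × ℕ))) :=
  P.sigma fun p => Finset.Icc 1 (p / 2) ×ˢ
    (Finset.Ico (8 * (M / p)) (9 * (M / p)) ×ˢ Finset.Ico (8 * (M / p)) (9 * (M / p)))

theorem quadrupleParams_bounds {P : Finset ℕ} {M : ℕ} (hP : ∀ p ∈ P, p.Prime)
    (hM : ∀ p ∈ P, p ≤ M) {p u x y : ℕ} (h : ⟨p, u, x, y⟩ ∈ quadrupleParams P M) :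
    p.Prime ∧ 0 < u ∧ u < p ∧ 0 < x ∧ 0 < y ∧ M + u * y ≤ p * x ∧ M + u * x ≤ p * y ∧
      p * x + u * y ≤ 16 * M ∧ p * y + u * x ≤ 16 * M := by
  simp only [quadrupleParams, Finset.mem_sigma, Finset.mem_product, Finset.mem_Icc,
    Finset.mem_Ico] at h
  obtain ⟨hp, ⟨hu1, hu2⟩, ⟨hx1, hx2⟩, hy1, hy2⟩ := h
  have hpp := hP p hp
  have hpos := hpp.pos
  have ht : 1 ≤ M / p := (Nat.one_le_div_iff hpos).2 (hM p hp)
  have htM : p * (M / p) ≤ M := Nat.mul_div_le M p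
  have hMt : M < p * (M / p) + p := by
    have := Nat.div_add_mod M p
    have := Nat.mod_lt M hpos
    omega
  set t := M / p
  have hpt : p ≤ p * t := Nat.le_mul_of_pos_right p ht
  have h2u : 2 * u ≤ p := by omega
  have hpx : p * (8 * t) ≤ p * x := Nat.mul_le_mul_left p hx1
  have hpy : p * (8 * t) ≤ p * y := Nat.mul_le_mul_left p hy1
  have hpx' : p * x ≤ p * (9 * t) := Nat.mul_le_mul_left p hx2.le
  have hpy' : p * y ≤ p * (9 * t) := Nat.mul_le_mul_left p hy2.le
  have hux : 2 * u * x ≤ p * (9 * t) := Nat.mul_le_mul h2u hx2.le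
  have huy : 2 * u * y ≤ p * (9 * t) := Nat.mul_le_mul h2u hy2.le
  have e8 : p * (8 * t) = 8 * (p * t) := by ring
  have e9 : p * (9 * t) = 9 * (p * t) := by ring
  have ex : 2 * u * x = 2 * (u * x) := by ring
  have ey : 2 * u * y = 2 * (u * y) := by ring
  refine ⟨hpp, hu1, by omega, by omega, by omega, by omega, by omega, by omega, by omega⟩

theorem injOn_squareQuadruple {P : Finset ℕ} {M : ℕ} (hP : ∀ p ∈ P, p.Prime)
    (hM : ∀ p ∈ P, p ≤ M) : Set.InjOn squareQuadruple (quadrupleParams P M) := by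
  rintro ⟨p, u, x, y⟩ h ⟨p', u', x', y'⟩ h' he
  obtain ⟨hp, hu, hup, hx, hy, h1, h2, -, -⟩ := quadrupleParams_bounds hP hM h
  obtain ⟨hp', hu', hup', hx', hy', h1', h2', -, -⟩ := quadrupleParams_bounds hP hM h'
  simp only [squareQuadruple, Prod.mk.injEq] at he
  obtain ⟨⟨e1, e2⟩, e3, e4⟩ := he
  have a1 : p * x = p' * x' := by omega
  have a2 : u * x = u' * x' := by omega
  have a3 : p * y = p' * y' := by omega
  have key : u * p' = u' * p := by
    have : (u * p') * (x * x') = (u' * p) * (x * x') := by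
      calc (u * p') * (x * x') = (u * x) * (p' * x') := by ring
        _ = (u' * x') * (p * x) := by rw [a2, a1]
        _ = (u' * p) * (x * x') := by ring
    exact Nat.eq_of_mul_eq_mul_right (Nat.mul_pos hx hx') this
  have hdvd : p ∣ u * p' := key ▸ Dvd.intro_left u' rfl
  have hpp : p = p' := by
    rcases (Nat.Prime.dvd_mul hp).1 hdvd with hd | hd
    · exact absurd (Nat.le_of_dvd hu hd) (by omega)
    · exact (Nat.prime_dvd_prime_iff_eq hp hp').1 hd
  subst hpp
  obtain rfl := Nat.eq_of_mul_eq_mul_right hp.pos key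
  obtain rfl := Nat.eq_of_mul_eq_mul_left hp.pos a1
  obtain rfl := Nat.eq_of_mul_eq_mul_left hp.pos a3
  rfl

theorem le_card_quadrupleParams {P : Finset ℕ} {M : ℕ} (hP : ∀ p ∈ P, p.Prime)
    (hM : ∀ p ∈ P, p ≤ M) :
    (M : ℝ) ^ 2 / 12 * ∑ p ∈ P, 1 / (p : ℝ) ≤ (quadrupleParams P M).card := by
  rw [quadrupleParams, Finset.card_sigma, Nat.cast_sum, Finset.mul_sum]
  refine Finset.sum_le_sum fun p hp => ?_
  have hpos : 0 < p := (hP p hp).pos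
  have h2 := (hP p hp).two_le
  simp only [Finset.card_product, Nat.card_Icc, Nat.card_Ico]
  have ht : 1 ≤ M / p := (Nat.one_le_div_iff hpos).2 (hM p hp)
  have hMt : M ≤ 2 * p * (M / p) := by
    have := Nat.div_add_mod M p
    have := Nat.mod_lt M hpos
    have : p ≤ p * (M / p) := Nat.le_mul_of_pos_right p ht
    have : 2 * p * (M / p) = 2 * (p * (M / p)) := by ring
    omega
  have e1 : p / 2 + 1 - 1 = p / 2 := by omega
  have e2 : 9 * (M / p) - 8 * (M / p) = M / p := by omega
  rw [e1, e2]
  have h3 : p ≤ 3 * (p / 2) := by omega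
  generalize M / p = t at *
  generalize p / 2 = v at *
  have hMt' : (M : ℝ) ≤ 2 * p * t := by exact_mod_cast hMt
  have h3' : (p : ℝ) ≤ 3 * v := by exact_mod_cast h3
  have hp0 : (0 : ℝ) < p := by exact_mod_cast hpos
  push_cast
  calc (M : ℝ) ^ 2 / 12 * (1 / p) ≤ (2 * (p : ℝ) * t) ^ 2 / 12 * (1 / p) := by gcongr
    _ = (p : ℝ) / 3 * (t * t) := by field_simp; ring
    _ ≤ (v : ℝ) * (t * t) := by gcongr; linarith

theorem exists_primes_le_sum_one_div (K : ℝ) :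
    ∃ P : Finset ℕ, (∀ p ∈ P, p.Prime) ∧ K ≤ ∑ p ∈ P, 1 / (p : ℝ) := by
  have h := (not_summable_iff_tendsto_nat_atTop_of_nonneg (fun n => Set.indicator_nonneg
    (fun n _ => by positivity) n)).1 not_summable_one_div_on_primes
  obtain ⟨n, hn⟩ := (h.eventually_ge_atTop K).exists
  refine ⟨(Finset.range n).filter Nat.Prime, fun p hp => (Finset.mem_filter.1 hp).2, ?_⟩
  rw [Finset.sum_filter]
  simpa [Set.indicator_apply] using hn

/-- The coefficients of the tail `∑_{n ≥ M} e^{2πin²x}/n²`. -/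
noncomputable def tailCoeff (M n : ℕ) : ℝ := if M ≤ n then 1 / (n : ℝ) ^ 2 else 0

theorem tailCoeff_nonneg (M n : ℕ) : 0 ≤ tailCoeff M n := by
  unfold tailCoeff
  split_ifs <;> positivity

theorem summable_tailCoeff (M : ℕ) : Summable (tailCoeff M) := by
  refine Summable.of_nonneg_of_le (tailCoeff_nonneg M) (fun n => ?_)
    (Real.summable_one_div_nat_pow.2 one_lt_two)
  unfold tailCoeff
  split_ifs
  · exact le_rfl
  · positivity

theorem sum_sq_tailCoeff_le {M : ℕ} (hM : 0 < M) (L : ℕ) :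
    ∑ n ∈ Finset.range L, tailCoeff M n ^ 2 ≤ 8 / (M : ℝ) ^ 3 - 8 / ((max M L : ℕ) : ℝ) ^ 3 := by
  induction L with
  | zero => simp
  | succ L ih =>
    rw [Finset.sum_range_succ]
    rcases lt_or_ge L M with h | h
    · rw [max_eq_left h.le] at ih
      rw [max_eq_left (by omega), tailCoeff, if_neg (by omega)]
      simpa using ih
    · rw [max_eq_right h] at ih
      rw [max_eq_right (by omega), tailCoeff, if_pos h]
      have hL : (1 : ℝ) ≤ L := by exact_mod_cast hM.trans_le h
      have key : (1 / (L : ℝ) ^ 2) ^ 2 ≤ 8 / (L : ℝ) ^ 3 - 8 / ((L : ℝ) + 1) ^ 3 := by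
        have e : 8 / (L : ℝ) ^ 3 - 8 / ((L : ℝ) + 1) ^ 3 - (1 / (L : ℝ) ^ 2) ^ 2 =
            (8 * L * (3 * L ^ 2 + 3 * L + 1) - (L + 1) ^ 3) / (L ^ 4 * (L + 1) ^ 3) := by
          field_simp
          ring
        have : 0 ≤ (8 * (L : ℝ) * (3 * L ^ 2 + 3 * L + 1) - (L + 1) ^ 3) /
            (L ^ 4 * (L + 1) ^ 3) := by
          refine div_nonneg ?_ (by positivity)
          nlinarith [pow_nonneg (zero_le_one.trans hL) 3, mul_nonneg (zero_le_one.trans hL)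
            (sub_nonneg.2 hL)]
        linarith
      push_cast
      linarith

theorem RiemannHigh_eq_tsum {N : ℕ} (hN : 0 < N) (x : ℝ) :
    RiemannHigh N x =
      ∑' n : ℕ, (tailCoeff (Nat.sqrt (N - 1) + 1) n : ℂ) * eChar (n ^ 2) x := by
  have hinj : Function.Injective fun n : ℕ => n ^ 2 := Nat.pow_left_injective two_ne_zero
  rw [RiemannHigh, ← hinj.tsum_eq]
  · refine tsum_congr fun n => ?_
    have hiff : N ≤ n ^ 2 ↔ Nat.sqrt (N - 1) + 1 ≤ n := by
      rw [Nat.succ_le_iff, Nat.sqrt_lt']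
      omega
    have hsq : IsSquare (n ^ 2) := IsSquare.sq n
    simp only [hiff, tailCoeff, sqIndicator, if_pos hsq]
    split_ifs <;> simp
  · intro k hk
    by_contra hne
    refine hk ?_
    have : ¬ IsSquare k := fun ⟨r, hr⟩ => hne ⟨r, by simp [hr, sq]⟩
    simp [sqIndicator, this]

theorem integral_norm_sq_RiemannHigh_bounds {N M : ℕ} (hN : 0 < N)
    (hM : M = Nat.sqrt (N - 1) + 1) :
    0 < ∫ x in (0:ℝ)..1, ‖RiemannHigh N x‖ ^ 2 ∧
      ∫ x in (0:ℝ)..1, ‖RiemannHigh N x‖ ^ 2 ≤ 8 / (M : ℝ) ^ 3 := by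
  have hM0 : 0 < M := by omega
  simp_rw [RiemannHigh_eq_tsum hN, ← hM]
  have ht := tendsto_sum_sq_integral_norm_sq (tailCoeff_nonneg M) (summable_tailCoeff M)
    (fun n => n ^ 2) (Nat.pow_left_injective two_ne_zero)
  constructor
  · have hpos : 0 < tailCoeff M M ^ 2 := by
      rw [tailCoeff, if_pos le_rfl]
      positivity
    refine hpos.trans_le (ge_of_tendsto ht ?_)
    filter_upwards [Filter.eventually_gt_atTop M] with L hL
    exact Finset.single_le_sum (f := fun n => tailCoeff M n ^ 2) (fun n _ => sq_nonneg _)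
      (Finset.mem_range.2 hL)
  · refine le_of_tendsto' ht fun L => (sum_sq_tailCoeff_le hM0 L).trans ?_
    exact sub_le_self _ (by positivity)

theorem le_tailCoeff {M n : ℕ} (hM : 0 < M) (h : M ≤ n) (h' : n ≤ 16 * M) :
    1 / (16 * (M : ℝ)) ^ 2 ≤ tailCoeff M n := by
  rw [tailCoeff, if_pos h]
  have : (0 : ℝ) < n := by exact_mod_cast hM.trans_le h
  have : (n : ℝ) ≤ 16 * M := by exact_mod_cast h'
  gcongr

theorem le_integral_norm_pow_four_RiemannHigh {N M : ℕ} (hN : 0 < N)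
    (hM : M = Nat.sqrt (N - 1) + 1) {P : Finset ℕ} (hP : ∀ p ∈ P, p.Prime)
    (hPM : ∀ p ∈ P, p ≤ M) :
    (quadrupleParams P M).card * (1 / (16 * (M : ℝ)) ^ 2) ^ 4 ≤
      ∫ x in (0:ℝ)..1, ‖RiemannHigh N x‖ ^ 4 := by
  have hM0 : 0 < M := by omega
  simp_rw [RiemannHigh_eq_tsum hN, ← hM]
  refine le_trans ?_ (sum_quadruples_le_integral_norm_pow_four (tailCoeff_nonneg M)
    (summable_tailCoeff M) (fun n => n ^ 2) ((quadrupleParams P M).image squareQuadruple) ?_)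
  · rw [Finset.sum_image (injOn_squareQuadruple hP hPM), ← nsmul_eq_mul, ← Finset.sum_const]
    refine Finset.sum_le_sum ?_
    rintro ⟨p, u, x, y⟩ hi
    obtain ⟨-, -, -, -, -, h1, h2, h3, h4⟩ := quadrupleParams_bounds hP hPM hi
    have hδ : 0 ≤ 1 / (16 * (M : ℝ)) ^ 2 := by positivity
    have key : ∀ a b c d : ℕ, M ≤ a → a ≤ 16 * M → M ≤ b → b ≤ 16 * M → M ≤ c → c ≤ 16 * M →
        M ≤ d → d ≤ 16 * M → (1 / (16 * (M : ℝ)) ^ 2) ^ 4 ≤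
          (tailCoeff M a * tailCoeff M b) * (tailCoeff M c * tailCoeff M d) := by
      intro a b c d ha ha' hb hb' hc hc' hd hd'
      calc (1 / (16 * (M : ℝ)) ^ 2) ^ 4 =
          (1 / (16 * (M : ℝ)) ^ 2 * (1 / (16 * (M : ℝ)) ^ 2)) *
            (1 / (16 * (M : ℝ)) ^ 2 * (1 / (16 * (M : ℝ)) ^ 2)) := by ring
        _ ≤ _ := mul_le_mul
            (mul_le_mul (le_tailCoeff hM0 ha ha') (le_tailCoeff hM0 hb hb') hδ
              (tailCoeff_nonneg _ _))
            (mul_le_mul (le_tailCoeff hM0 hc hc') (le_tailCoeff hM0 hd hd') hδ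
              (tailCoeff_nonneg _ _))
            (mul_nonneg hδ hδ) (mul_nonneg (tailCoeff_nonneg _ _) (tailCoeff_nonneg _ _))
    apply key <;> simp only [squareQuadruple] <;> omega
  · intro q hq
    obtain ⟨⟨p, u, x, y⟩, hi, rfl⟩ := Finset.mem_image.1 hq
    obtain ⟨-, -, -, -, -, h1, h2, -, -⟩ := quadrupleParams_bounds hP hPM hi
    simp only [squareQuadruple]
    have hx : u * y ≤ p * x := by omega
    have hy : u * x ≤ p * y := by omega
    zify [hx, hy]
    ring

/-- Riemann's non-differentiable function is intermittent in the sense of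
high-pass filtering: `F_R(N) → +∞` as `N → ∞`. -/
theorem riemann_intermittent_HP :
    Filter.Tendsto flatnessHP Filter.atTop Filter.atTop := by
  rw [Filter.tendsto_atTop]
  intro K
  obtain ⟨P, hP, hK⟩ := exists_primes_le_sum_one_div (12 * 64 * 16 ^ 8 * max K 0)
  filter_upwards [Filter.eventually_ge_atTop (P.sup id ^ 2 + 1)] with N hN
  have hN0 : 0 < N := by omega
  obtain ⟨M, hM⟩ : ∃ M, M = Nat.sqrt (N - 1) + 1 := ⟨_, rfl⟩
  have hPM : ∀ p ∈ P, p ≤ M := by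
    intro p hp
    have h1 : p ≤ P.sup id := Finset.le_sup (f := id) hp
    have h2 : P.sup id ≤ Nat.sqrt (N - 1) := Nat.le_sqrt'.2 (by omega)
    omega
  have hM0 : (0 : ℝ) < M := by
    rw [hM]
    positivity
  obtain ⟨hpos, hle⟩ := integral_norm_sq_RiemannHigh_bounds hN0 hM
  rw [flatnessHP, le_div_iff₀ (pow_pos hpos 2)]
  calc K * (∫ x in (0:ℝ)..1, ‖RiemannHigh N x‖ ^ 2) ^ 2
      ≤ max K 0 * (8 / (M : ℝ) ^ 3) ^ 2 := by
        gcongr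
        exact le_max_left _ _
    _ = (M : ℝ) ^ 2 / 12 * (12 * 64 * 16 ^ 8 * max K 0) * (1 / (16 * (M : ℝ)) ^ 2) ^ 4 := by
        field_simp
        ring
    _ ≤ (quadrupleParams P M).card * (1 / (16 * (M : ℝ)) ^ 2) ^ 4 := by
        gcongr
        exact le_trans (by gcongr) (le_card_quadrupleParams hP hPM)
    _ ≤ _ := le_integral_norm_pow_four_RiemannHigh hN0 hM hP hPM
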